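/- arXiv:2012.15154 — 2 statements merged into one kernel-verified Lean document; each statement's English description precedes it below -/
import Mathlib

section
/- In the RA model with a stubborn agent, for every ordinary agent k ∈ {1,…,K−1}, E[(Y_k[n](1 − Y_k[n]))²] → 0 as n → ∞. -/
open MeasureTheory Filter

/-- **The Random Actions (RA) model with a stubborn agent.**
`K = m + 1 ≥ 2` agents, agent `0` being the stubborn one; `α ∈ (0,1)`; `T` a row-stochastic
trust matrix with first row `(1,0,…,0)`, written in block form `T = [[1,0],[r,Q]]` where
`r i = T (i+1) 0` and `Q i j = T (i+1) (j+1)`; `Q` is irreducible and `r` has a positive entry.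
On a probability space with filtration `ℱ`, the opinion process `X n` takes values in `[0,1]^K`,
is adapted, and satisfies `X_0[n] = 0` a.s.; the action process `A n` takes values in `{0,1}^K`,
is `ℱ (n+1)`-measurable, satisfies `A_0[n] = 0` a.s., and conditionally on `ℱ n` its coordinates
are independent Bernoulli with parameters `X n` (encoded by `hA_cond`: for every finite set `s`
of agents, `E[∏_{k ∈ s} A_k[n] | ℱ n] = ∏_{k ∈ s} X_k[n]` a.s.); the update rule is
`X[n+1] = (1-α) X[n] + α T A[n]`. -/
structure RAStubbornModel (m : ℕ) (Ω : Type*) [mΩ : MeasurableSpace Ω] (μ : Measure Ω) where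
  α : ℝ
  T : Matrix (Fin (m + 1)) (Fin (m + 1)) ℝ
  ℱ : Filtration ℕ mΩ
  X : ℕ → Ω → Fin (m + 1) → ℝ
  A : ℕ → Ω → Fin (m + 1) → ℝ
  hα : α ∈ Set.Ioo (0 : ℝ) 1
  hT_nonneg : ∀ i j, 0 ≤ T i j
  hT_rowsum : ∀ i, ∑ j, T i j = 1
  hT_first : ∀ j, T 0 j = if j = 0 then (1 : ℝ) else 0
  hQ_irred : ∀ i j : Fin m, ∃ n, 1 ≤ n ∧
    0 < ((Matrix.of fun (a b : Fin m) => T a.succ b.succ) ^ n) i j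
  hr_pos : ∃ i : Fin m, 0 < T i.succ 0
  hX_mem : ∀ n ω k, X n ω k ∈ Set.Icc (0 : ℝ) 1
  hX_adapted : ∀ n, Measurable[ℱ n] (X n)
  hX_stub : ∀ n, ∀ᵐ ω ∂μ, X n ω 0 = 0
  hA_val : ∀ n ω k, A n ω k = 0 ∨ A n ω k = 1
  hA_meas : ∀ n, Measurable[ℱ (n + 1)] (A n)
  hA_stub : ∀ n, ∀ᵐ ω ∂μ, A n ω 0 = 0
  hA_cond : ∀ n (s : Finset (Fin (m + 1))),
    μ[fun ω => ∏ k ∈ s, A n ω k | ℱ n] =ᵐ[μ] fun ω => ∏ k ∈ s, X n ω k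
  h_update : ∀ n ω k, X (n + 1) ω k = (1 - α) * X n ω k + α * ∑ j, T k j * A n ω j

open Matrix in
/-- A nonnegative substochastic matrix that is irreducible and has a row of sum less than one
admits no nonzero nonnegative fixed vector. -/
theorem eq_zero_of_mulVec_eq_of_substochastic {m : ℕ} {Q : Matrix (Fin m) (Fin m) ℝ}
    (hQ : ∀ i j, 0 ≤ Q i j) (hsum : ∀ i, ∑ j, Q i j ≤ 1)
    (hirr : ∀ i j, ∃ n, 1 ≤ n ∧ 0 < (Q ^ n) i j) {j : Fin m} (hj : ∑ l, Q j l < 1)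
    {v : Fin m → ℝ} (hv : ∀ i, 0 ≤ v i) (hfix : Q *ᵥ v = v) : v = 0 := by
  have : Nonempty (Fin m) := ⟨j⟩
  obtain ⟨i, hi⟩ := Finite.exists_max v
  have hpow_nonneg : ∀ n a b, 0 ≤ (Q ^ n) a b := fun n ↦ by
    induction n with
    | zero => intro a b; rw [pow_zero, Matrix.one_apply]; split_ifs <;> norm_num
    | succ n ih =>
      intro a b
      rw [pow_succ, Matrix.mul_apply]
      exact Finset.sum_nonneg fun c _ ↦ mul_nonneg (ih a c) (hQ c b)
  have hpow_sum : ∀ n a, ∑ b, (Q ^ n) a b ≤ 1 := fun n ↦ by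
    induction n with
    | zero => intro a; simp [Matrix.one_apply]
    | succ n ih =>
      intro a
      simp_rw [pow_succ, Matrix.mul_apply]
      rw [Finset.sum_comm]
      simp_rw [← Finset.mul_sum]
      refine (Finset.sum_le_sum fun c _ ↦ ?_).trans (ih a)
      exact mul_le_of_le_one_right (hpow_nonneg n a c) (hsum c)
  have hpow_fix : ∀ n, (Q ^ n) *ᵥ v = v := fun n ↦ by
    induction n with
    | zero => simp
    | succ n ih => rw [pow_succ, ← Matrix.mulVec_mulVec, hfix, ih]
  have hmax : v i ≤ 0 := by
    by_contra! hpos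
    have hvj : v j < v i := by
      calc v j = ∑ l, Q j l * v l := (congrFun hfix j).symm
        _ ≤ ∑ l, Q j l * v i :=
          Finset.sum_le_sum fun l _ ↦ mul_le_mul_of_nonneg_left (hi l) (hQ j l)
        _ = (∑ l, Q j l) * v i := by rw [Finset.sum_mul]
        _ < v i := mul_lt_of_lt_one_left hpos hj
    obtain ⟨n, -, hn⟩ := hirr i j
    have : v i < v i := by
      calc v i = ∑ l, (Q ^ n) i l * v l := (congrFun (hpow_fix n) i).symm
        _ < ∑ l, (Q ^ n) i l * v i :=
          Finset.sum_lt_sum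
            (fun l _ ↦ mul_le_mul_of_nonneg_left (hi l) (hpow_nonneg n i l))
            ⟨j, Finset.mem_univ j, mul_lt_mul_of_pos_left hvj hn⟩
        _ = (∑ l, (Q ^ n) i l) * v i := by rw [Finset.sum_mul]
        _ ≤ v i := mul_le_of_le_one_left hpos.le (hpow_sum n i)
    exact this.false
  exact funext fun l ↦ le_antisymm ((hi l).trans hmax) (hv l)

open Matrix in
/-- Sequences in `[0,1]^m` driven by the lazy version of an irreducible, strictly substochastic
matrix tend to zero. -/
theorem tendsto_zero_of_lazy_substochastic {m : ℕ} {Q : Matrix (Fin m) (Fin m) ℝ}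
    (hQ : ∀ i j, 0 ≤ Q i j) (hsum : ∀ i, ∑ j, Q i j ≤ 1)
    (hirr : ∀ i j, ∃ n, 1 ≤ n ∧ 0 < (Q ^ n) i j) {j : Fin m} (hj : ∑ l, Q j l < 1)
    {α : ℝ} (hα : α ∈ Set.Ioo (0 : ℝ) 1) {e : ℕ → Fin m → ℝ}
    (he : ∀ n i, e n i ∈ Set.Icc (0 : ℝ) 1)
    (hrec : ∀ n i, e (n + 1) i = (1 - α) * e n i + α * ∑ l, Q i l * e n l) (i : Fin m) :
    Tendsto (fun n ↦ e n i) atTop (nhds 0) := by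
  obtain ⟨hα0, hα1⟩ := hα
  let P : (Fin m → ℝ) → Fin m → ℝ := fun x a ↦ (1 - α) * x a + α * ∑ l, Q a l * x l
  have hPmono : Monotone P := fun x y hxy a ↦
    add_le_add (mul_le_mul_of_nonneg_left (hxy a) (by linarith))
      (mul_le_mul_of_nonneg_left
        (Finset.sum_le_sum fun l _ ↦ mul_le_mul_of_nonneg_left (hxy l) (hQ a l)) hα0.le)
  have hPcont : Continuous P := by fun_prop
  let u : ℕ → Fin m → ℝ := fun n ↦ P^[n] 1
  have hu_succ : ∀ n, u (n + 1) = P (u n) := fun n ↦ Function.iterate_succ_apply' P n 1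
  have hP1 : P 1 ≤ 1 := fun a ↦ by
    have := mul_le_mul_of_nonneg_left (hsum a) hα0.le
    simp only [P, Pi.one_apply, mul_one] at this ⊢
    linarith
  have hu_anti : Antitone u := hPmono.antitone_iterate_of_map_le hP1
  have he_le : ∀ n, e n ≤ u n := fun n ↦ by
    induction n with
    | zero => exact fun a ↦ (he 0 a).2
    | succ n ih =>
      rw [hu_succ]
      exact fun a ↦ (hrec n a).le.trans (hPmono ih a)
  have hu_nonneg : ∀ n a, 0 ≤ u n a := fun n a ↦ (he n a).1.trans (he_le n a)
  let v : Fin m → ℝ := fun a ↦ ⨅ n, u n a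
  have hlim : Tendsto u atTop (nhds v) := tendsto_pi_nhds.2 fun a ↦
    tendsto_atTop_ciInf (fun _ _ h ↦ hu_anti h a) ⟨0, by rintro _ ⟨n, rfl⟩; exact hu_nonneg n a⟩
  have hfixP : P v = v := by
    refine tendsto_nhds_unique ((hPcont.tendsto v).comp hlim) ?_
    simpa only [Function.comp_def, ← hu_succ] using (tendsto_add_atTop_iff_nat 1).2 hlim
  have hfix : Q *ᵥ v = v := funext fun a ↦ by
    have h : (1 - α) * v a + α * (Q *ᵥ v) a = v a := congrFun hfixP a
    exact mul_left_cancel₀ hα0.ne' (by linarith)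
  have hv0 : v = 0 := eq_zero_of_mulVec_eq_of_substochastic hQ hsum hirr hj
    (fun a ↦ Real.iInf_nonneg fun n ↦ hu_nonneg n a) hfix
  have hlim_i : Tendsto (fun n ↦ u n i) atTop (nhds 0) := by
    simpa [hv0] using tendsto_pi_nhds.1 hlim i
  exact squeeze_zero (fun n ↦ (he n i).1) (fun n ↦ he_le n i) hlim_i

namespace RAStubbornModel

variable {m : ℕ} {Ω : Type*} [MeasurableSpace Ω] {μ : Measure Ω} [IsProbabilityMeasure μ]
  (M : RAStubbornModel m Ω μ)

theorem integrable_X (n : ℕ) (k : Fin (m + 1)) : Integrable (fun ω ↦ M.X n ω k) μ :=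
  Integrable.of_mem_Icc 0 1
    ((measurable_pi_apply k).comp ((M.hX_adapted n).mono (M.ℱ.le n) le_rfl)).aemeasurable
    (ae_of_all _ fun ω ↦ M.hX_mem n ω k)

theorem integrable_A (n : ℕ) (k : Fin (m + 1)) : Integrable (fun ω ↦ M.A n ω k) μ :=
  Integrable.of_mem_Icc 0 1
    ((measurable_pi_apply k).comp ((M.hA_meas n).mono (M.ℱ.le (n + 1)) le_rfl)).aemeasurable
    (ae_of_all _ fun ω ↦ by rcases M.hA_val n ω k with h | h <;> simp [h])

theorem integral_A (n : ℕ) (k : Fin (m + 1)) : ∫ ω, M.A n ω k ∂μ = ∫ ω, M.X n ω k ∂μ := by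
  have h := M.hA_cond n {k}
  simp only [Finset.prod_singleton] at h
  rw [← integral_congr_ae h, integral_condExp (M.ℱ.le n)]

theorem integral_X_mem (n : ℕ) (k : Fin (m + 1)) : ∫ ω, M.X n ω k ∂μ ∈ Set.Icc (0 : ℝ) 1 := by
  refine ⟨integral_nonneg fun ω ↦ (M.hX_mem n ω k).1, ?_⟩
  simpa using integral_mono (M.integrable_X n k) (integrable_const (1 : ℝ))
    fun ω ↦ (M.hX_mem n ω k).2

theorem integral_X_succ (n : ℕ) (k : Fin (m + 1)) :
    ∫ ω, M.X (n + 1) ω k ∂μ =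
      (1 - M.α) * ∫ ω, M.X n ω k ∂μ + M.α * ∑ j, M.T k j * ∫ ω, M.X n ω j ∂μ := by
  have hint : ∀ j ∈ Finset.univ, Integrable (fun ω ↦ M.T k j * M.A n ω j) μ :=
    fun j _ ↦ (M.integrable_A n j).const_mul _
  simp_rw [M.h_update]
  rw [integral_add ((M.integrable_X n k).const_mul _)
    ((integrable_finsetSum _ hint).const_mul _), integral_const_mul, integral_const_mul,
    integral_finsetSum _ hint]
  simp_rw [integral_const_mul, M.integral_A]

/-- The expected opinion of every ordinary agent tends to the stubborn agent's opinion. -/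
theorem tendsto_integral_X_succ (k : Fin m) :
    Tendsto (fun n ↦ ∫ ω, M.X n ω k.succ ∂μ) atTop (nhds 0) := by
  have hrow : ∀ i : Fin m, M.T i.succ 0 + ∑ j : Fin m, M.T i.succ j.succ = 1 := fun i ↦ by
    rw [← Fin.sum_univ_succ, M.hT_rowsum]
  obtain ⟨i, hi⟩ := M.hr_pos
  refine tendsto_zero_of_lazy_substochastic
    (Q := Matrix.of fun a b : Fin m ↦ M.T a.succ b.succ) (j := i) (α := M.α)
    (e := fun n a ↦ ∫ ω, M.X n ω a.succ ∂μ) (fun a b ↦ M.hT_nonneg _ _) (fun a ↦ ?_)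
    M.hQ_irred ?_ M.hα (fun n a ↦ M.integral_X_mem n a.succ) (fun n a ↦ ?_) k
  · have := hrow a
    have := M.hT_nonneg a.succ 0
    simp only [Matrix.of_apply]
    linarith
  · have := hrow i
    simp only [Matrix.of_apply]
    linarith
  · rw [M.integral_X_succ, Fin.sum_univ_succ, integral_eq_zero_of_ae (M.hX_stub n),
      mul_zero, zero_add]
    rfl

end RAStubbornModel

/-- **Mean-square vanishing of `Y_k (1 - Y_k)` for ordinary agents.**
In the RA model with a stubborn agent, for every ordinary agent `k` (agent `k+1`, i.e.
coordinate `k` of `Y[n] = (X_2[n],…,X_K[n])`), `E[(Y_k[n](1 - Y_k[n]))²] → 0` as `n → ∞`. -/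
theorem RA_stubborn_Y_product_ms_convergence {m : ℕ} (hm : 1 ≤ m) {Ω : Type*} [MeasurableSpace Ω]
    {μ : Measure Ω} [IsProbabilityMeasure μ] (M : RAStubbornModel m Ω μ) :
    ∀ k : Fin m,
      Tendsto (fun n => ∫ ω, (M.X n ω k.succ * (1 - M.X n ω k.succ)) ^ 2 ∂μ)
        atTop (nhds 0) := by
  intro k
  refine squeeze_zero (fun n ↦ integral_nonneg fun ω ↦ sq_nonneg _) (fun n ↦ ?_)
    (M.tendsto_integral_X_succ k)
  refine integral_mono_of_nonneg (ae_of_all _ fun ω ↦ sq_nonneg _) (M.integrable_X n k.succ)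
    (ae_of_all _ fun ω ↦ ?_)
  obtain ⟨h0, h1⟩ := M.hX_mem n ω k.succ
  have hle : M.X n ω k.succ * (1 - M.X n ω k.succ) ≤ M.X n ω k.succ :=
    mul_le_of_le_one_right h0 (by linarith)
  have hnn : 0 ≤ M.X n ω k.succ * (1 - M.X n ω k.succ) := mul_nonneg h0 (by linarith)
  exact (pow_le_of_le_one hnn (hle.trans h1) two_ne_zero).trans hle
end

section
/- In the RA model, for every agent k ∈ {1,…,K}, E[(X_k[n](1 − X_k[n]))²] → 0 as n → ∞; that is, the product X_k[n](1 − X_k[n]) converges to 0 in the mean square sense. -/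
open MeasureTheory Filter

/-- **The Random Actions (RA) opinion-dynamics model.**
`K` agents; `α ∈ (0,1)`; `T` a `K × K` row-stochastic trust matrix.  On a probability space with
filtration `ℱ`, the opinion process `X n : Ω → Fin K → ℝ` takes values in `[0,1]^K` and is
adapted; the action process `A n` takes values in `{0,1}^K`, is `ℱ (n+1)`-measurable, and
conditionally on `ℱ n` its coordinates are independent Bernoulli with parameters `X n`
(encoded by `hA_cond`: for every finite set `s` of agents,
`E[∏_{k ∈ s} A_k[n] | ℱ n] = ∏_{k ∈ s} X_k[n]` a.s.); the update rule is
`X[n+1] = (1-α) X[n] + α T A[n]`. -/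
structure RAModel (K : ℕ) (Ω : Type*) [mΩ : MeasurableSpace Ω] (μ : Measure Ω) where
  α : ℝ
  T : Matrix (Fin K) (Fin K) ℝ
  ℱ : Filtration ℕ mΩ
  X : ℕ → Ω → Fin K → ℝ
  A : ℕ → Ω → Fin K → ℝ
  hα : α ∈ Set.Ioo (0 : ℝ) 1
  hT_nonneg : ∀ i j, 0 ≤ T i j
  hT_rowsum : ∀ i, ∑ j, T i j = 1
  hX_mem : ∀ n ω k, X n ω k ∈ Set.Icc (0 : ℝ) 1
  hX_adapted : ∀ n, Measurable[ℱ n] (X n)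
  hA_val : ∀ n ω k, A n ω k = 0 ∨ A n ω k = 1
  hA_meas : ∀ n, Measurable[ℱ (n + 1)] (A n)
  hA_cond : ∀ n (s : Finset (Fin K)),
    μ[fun ω => ∏ k ∈ s, A n ω k | ℱ n] =ᵐ[μ] fun ω => ∏ k ∈ s, X n ω k
  h_update : ∀ n ω k, X (n + 1) ω k = (1 - α) * X n ω k + α * ∑ j, T k j * A n ω j

namespace RAModel

variable {K : ℕ} {Ω : Type*} [mΩ : MeasurableSpace Ω] {μ : Measure Ω}

lemma measurable_X (M : RAModel K Ω μ) (n : ℕ) (k : Fin K) : Measurable fun ω => M.X n ω k :=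
  (measurable_pi_apply k).comp ((M.hX_adapted n).mono (M.ℱ.le n) le_rfl)

lemma measurable_A (M : RAModel K Ω μ) (n : ℕ) (k : Fin K) : Measurable fun ω => M.A n ω k :=
  (measurable_pi_apply k).comp ((M.hA_meas n).mono (M.ℱ.le (n + 1)) le_rfl)

lemma norm_X_le_one (M : RAModel K Ω μ) (n : ℕ) (ω : Ω) (k : Fin K) : ‖M.X n ω k‖ ≤ 1 := by
  have h := M.hX_mem n ω k
  rw [Real.norm_eq_abs, abs_of_nonneg h.1]
  exact h.2

lemma norm_A_le_one (M : RAModel K Ω μ) (n : ℕ) (ω : Ω) (k : Fin K) : ‖M.A n ω k‖ ≤ 1 := by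
  rcases M.hA_val n ω k with h | h <;> simp [h]

/-- The `π`-weighted average opinion, a martingale when `π` is a left fixed vector of `T`. -/
def average (M : RAModel K Ω μ) (π : Fin K → ℝ) (n : ℕ) (ω : Ω) : ℝ :=
  ∑ k, π k * M.X n ω k

lemma average_succ (M : RAModel K Ω μ) {π : Fin K → ℝ}
    (hπ_eig : ∀ j, ∑ i, π i * M.T i j = π j) (n : ℕ) (ω : Ω) :
    M.average π (n + 1) ω
      = M.average π n ω + M.α * ∑ j, π j * (M.A n ω j - M.X n ω j) := by
  have h : ∑ i, π i * ∑ j, M.T i j * M.A n ω j = ∑ j, π j * M.A n ω j := by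
    simp_rw [Finset.mul_sum]
    rw [Finset.sum_comm]
    refine Finset.sum_congr rfl fun j _ => ?_
    rw [← hπ_eig j, Finset.sum_mul]
    exact Finset.sum_congr rfl fun i _ => by ring
  have h' : M.average π (n + 1) ω = (1 - M.α) * ∑ i, π i * M.X n ω i
      + M.α * ∑ i, π i * ∑ j, M.T i j * M.A n ω j := by
    simp only [average, M.h_update, Finset.mul_sum (s := Finset.univ) (a := M.α),
      Finset.mul_sum (s := Finset.univ) (a := 1 - M.α), ← Finset.sum_add_distrib]
    exact Finset.sum_congr rfl fun i _ => by rw [← Finset.mul_sum]; ring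
  rw [h', h]
  simp only [average, mul_sub, Finset.sum_sub_distrib]
  ring

lemma average_mem_Icc (M : RAModel K Ω μ) {π : Fin K → ℝ} (hπ_nonneg : ∀ k, 0 ≤ π k)
    (hπ_sum : ∑ k, π k = 1) (n : ℕ) (ω : Ω) : M.average π n ω ∈ Set.Icc (0 : ℝ) 1 := by
  refine ⟨Finset.sum_nonneg fun k _ => mul_nonneg (hπ_nonneg k) (M.hX_mem n ω k).1, ?_⟩
  rw [← hπ_sum]
  exact Finset.sum_le_sum fun k _ => mul_le_of_le_one_right (hπ_nonneg k) (M.hX_mem n ω k).2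

lemma X_mul_one_sub_mem_Icc (M : RAModel K Ω μ) (n : ℕ) (ω : Ω) (k : Fin K) :
    M.X n ω k * (1 - M.X n ω k) ∈ Set.Icc (0 : ℝ) 1 := by
  obtain ⟨h₀, h₁⟩ := M.hX_mem n ω k
  exact ⟨mul_nonneg h₀ (by linarith), mul_le_one₀ h₁ (by linarith) (by linarith)⟩

lemma integrable_X_mul {f : Ω → ℝ} (M : RAModel K Ω μ) (n : ℕ) (i : Fin K)
    (hf : Integrable f μ) : Integrable (fun ω => M.X n ω i * f ω) μ :=
  hf.bdd_mul (M.measurable_X n i).aestronglyMeasurable (.of_forall fun ω => M.norm_X_le_one n ω i)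

lemma integrable_A_mul {f : Ω → ℝ} (M : RAModel K Ω μ) (n : ℕ) (i : Fin K)
    (hf : Integrable f μ) : Integrable (fun ω => M.A n ω i * f ω) μ :=
  hf.bdd_mul (M.measurable_A n i).aestronglyMeasurable (.of_forall fun ω => M.norm_A_le_one n ω i)

lemma integrable_A_sub_X_mul {f : Ω → ℝ} (M : RAModel K Ω μ) (n : ℕ) (i : Fin K)
    (hf : Integrable f μ) : Integrable (fun ω => (M.A n ω i - M.X n ω i) * f ω) μ := by
  simp only [sub_mul]
  exact (M.integrable_A_mul n i hf).sub (M.integrable_X_mul n i hf)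

section Moments

variable [IsProbabilityMeasure μ]

lemma integrable_X (M : RAModel K Ω μ) (n : ℕ) (i : Fin K) :
    Integrable (fun ω => M.X n ω i) μ :=
  .of_bound (M.measurable_X n i).aestronglyMeasurable 1 (.of_forall fun ω => M.norm_X_le_one n ω i)

lemma integrable_A (M : RAModel K Ω μ) (n : ℕ) (i : Fin K) :
    Integrable (fun ω => M.A n ω i) μ :=
  .of_bound (M.measurable_A n i).aestronglyMeasurable 1 (.of_forall fun ω => M.norm_A_le_one n ω i)

lemma integral_prod_A (M : RAModel K Ω μ) (n : ℕ) (s : Finset (Fin K)) :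
    ∫ ω, ∏ k ∈ s, M.A n ω k ∂μ = ∫ ω, ∏ k ∈ s, M.X n ω k ∂μ := by
  rw [← integral_condExp (M.ℱ.le n)]
  exact integral_congr_ae (M.hA_cond n s)

lemma integral_A (M : RAModel K Ω μ) (n : ℕ) (i : Fin K) :
    ∫ ω, M.A n ω i ∂μ = ∫ ω, M.X n ω i ∂μ := by
  simpa using M.integral_prod_A n {i}

lemma integral_A_mul_A (M : RAModel K Ω μ) (n : ℕ) {i j : Fin K} (hij : i ≠ j) :
    ∫ ω, M.A n ω i * M.A n ω j ∂μ = ∫ ω, M.X n ω i * M.X n ω j ∂μ := by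
  simpa [Finset.prod_pair hij] using M.integral_prod_A n {i, j}

lemma integral_X_mul_A (M : RAModel K Ω μ) (n : ℕ) (i j : Fin K) :
    ∫ ω, M.X n ω i * M.A n ω j ∂μ = ∫ ω, M.X n ω i * M.X n ω j ∂μ := by
  rw [← integral_condExp (M.ℱ.le n)]
  have hX : StronglyMeasurable[M.ℱ n] fun ω => M.X n ω i :=
    ((measurable_pi_apply i).comp (M.hX_adapted n)).stronglyMeasurable
  have hA := M.hA_cond n {j}
  simp only [Finset.prod_singleton] at hA
  refine integral_congr_ae ?_
  filter_upwards [condExp_mul_of_stronglyMeasurable_left hX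
    (M.integrable_X_mul n i (M.integrable_A n j)) (M.integrable_A n j), hA] with ω h₁ h₂
  exact h₁.trans (by simp [h₂])

lemma integrable_A_sub_X (M : RAModel K Ω μ) (n : ℕ) (i : Fin K) :
    Integrable (fun ω => M.A n ω i - M.X n ω i) μ :=
  (M.integrable_A n i).sub (M.integrable_X n i)

lemma integral_X_mul_A_sub_X (M : RAModel K Ω μ) (n : ℕ) (i j : Fin K) :
    ∫ ω, M.X n ω i * (M.A n ω j - M.X n ω j) ∂μ = 0 := by
  simp only [mul_sub]
  rw [integral_sub (M.integrable_X_mul n i (M.integrable_A n j))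
    (M.integrable_X_mul n i (M.integrable_X n j)), M.integral_X_mul_A, sub_self]

lemma integral_A_sub_X_mul (M : RAModel K Ω μ) (n : ℕ) (i j : Fin K) :
    ∫ ω, (M.A n ω i - M.X n ω i) * (M.A n ω j - M.X n ω j) ∂μ
      = ∫ ω, M.A n ω i * M.A n ω j ∂μ - ∫ ω, M.X n ω i * M.X n ω j ∂μ := by
  have h (ω : Ω) : (M.A n ω i - M.X n ω i) * (M.A n ω j - M.X n ω j)
      = M.A n ω i * M.A n ω j - M.X n ω j * M.A n ω i
        - M.X n ω i * (M.A n ω j - M.X n ω j) := by ring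
  simp only [h]
  have hAA := M.integrable_A_mul n i (M.integrable_A n j)
  have hXA := M.integrable_X_mul n j (M.integrable_A n i)
  have hsub : Integrable (fun ω => M.A n ω i * M.A n ω j - M.X n ω j * M.A n ω i) μ :=
    hAA.sub hXA
  rw [integral_sub hsub (M.integrable_X_mul n i (M.integrable_A_sub_X n j)),
    integral_sub hAA hXA, M.integral_X_mul_A_sub_X, M.integral_X_mul_A, sub_zero]
  simp only [mul_comm]

lemma integral_A_sub_X_mul_of_ne (M : RAModel K Ω μ) (n : ℕ) {i j : Fin K} (hij : i ≠ j) :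
    ∫ ω, (M.A n ω i - M.X n ω i) * (M.A n ω j - M.X n ω j) ∂μ = 0 := by
  rw [M.integral_A_sub_X_mul, M.integral_A_mul_A n hij, sub_self]

lemma integral_A_sub_X_mul_self (M : RAModel K Ω μ) (n : ℕ) (i : Fin K) :
    ∫ ω, (M.A n ω i - M.X n ω i) * (M.A n ω i - M.X n ω i) ∂μ
      = ∫ ω, M.X n ω i * (1 - M.X n ω i) ∂μ := by
  have h (ω : Ω) : M.A n ω i * M.A n ω i = M.A n ω i := by
    rcases M.hA_val n ω i with h | h <;> simp [h]
  simp only [M.integral_A_sub_X_mul, h, M.integral_A]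
  rw [← integral_sub (M.integrable_X n i) (M.integrable_X_mul n i (M.integrable_X n i))]
  simp only [mul_sub, mul_one]

lemma integral_average_sq_succ (M : RAModel K Ω μ) {π : Fin K → ℝ}
    (hπ_eig : ∀ j, ∑ i, π i * M.T i j = π j) (n : ℕ) :
    ∫ ω, M.average π (n + 1) ω ^ 2 ∂μ = ∫ ω, M.average π n ω ^ 2 ∂μ
      + M.α ^ 2 * ∑ k, π k ^ 2 * ∫ ω, M.X n ω k * (1 - M.X n ω k) ∂μ := by
  have hexp (ω : Ω) : M.average π (n + 1) ω ^ 2 = M.average π n ω ^ 2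
      + 2 * M.α * ∑ i, ∑ j, π i * π j * (M.X n ω i * (M.A n ω j - M.X n ω j))
      + M.α ^ 2 * ∑ i, ∑ j, π i * π j *
        ((M.A n ω i - M.X n ω i) * (M.A n ω j - M.X n ω j)) := by
    have hsum (f g : Fin K → ℝ) :
        ∑ i, ∑ j, π i * π j * (f i * g j) = (∑ i, π i * f i) * ∑ j, π j * g j := by
      rw [Finset.sum_mul_sum]
      exact Finset.sum_congr rfl fun i _ => Finset.sum_congr rfl fun j _ => by ring
    rw [M.average_succ hπ_eig, hsum, hsum fun i => M.A n ω i - M.X n ω i, average]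
    ring
  have hXX : Integrable (fun ω => M.average π n ω ^ 2) μ := by
    simp only [average, sq, Finset.sum_mul, mul_assoc, Finset.mul_sum]
    exact integrable_finsetSum _ fun i _ => integrable_finsetSum _ fun j _ =>
      (M.integrable_X_mul n j ((M.integrable_X n i).const_mul _)).const_mul _
  have hXD (i j : Fin K) : Integrable
      (fun ω => π i * π j * (M.X n ω i * (M.A n ω j - M.X n ω j))) μ :=
    (M.integrable_X_mul n i (M.integrable_A_sub_X n j)).const_mul _
  have hDD (i j : Fin K) : Integrable (fun ω => π i * π j *
      ((M.A n ω i - M.X n ω i) * (M.A n ω j - M.X n ω j))) μ :=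
    (M.integrable_A_sub_X_mul n i (M.integrable_A_sub_X n j)).const_mul _
  have hXD' := (integrable_finsetSum Finset.univ fun i _ =>
    integrable_finsetSum Finset.univ fun j _ => hXD i j).const_mul (2 * M.α)
  have hDD' := (integrable_finsetSum Finset.univ fun i _ =>
    integrable_finsetSum Finset.univ fun j _ => hDD i j).const_mul (M.α ^ 2)
  simp only [hexp]
  rw [integral_add (hXX.fun_add hXD') hDD', integral_add hXX hXD', integral_const_mul,
    integral_const_mul,
    integral_finsetSum _ fun i _ => integrable_finsetSum Finset.univ fun j _ => hXD i j,
    integral_finsetSum _ fun i _ => integrable_finsetSum Finset.univ fun j _ => hDD i j]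
  simp only [integral_finsetSum _ fun j _ => hXD _ j, integral_finsetSum _ fun j _ => hDD _ j,
    integral_const_mul, M.integral_X_mul_A_sub_X, mul_zero, Finset.sum_const_zero, add_zero]
  congr 2
  refine Finset.sum_congr rfl fun i _ => ?_
  rw [Finset.sum_eq_single i
    (fun j _ hj => by rw [M.integral_A_sub_X_mul_of_ne n hj.symm, mul_zero])
    (fun h => absurd (Finset.mem_univ i) h), M.integral_A_sub_X_mul_self, sq]

lemma integrable_X_mul_one_sub (M : RAModel K Ω μ) (n : ℕ) (k : Fin K) :
    Integrable (fun ω => M.X n ω k * (1 - M.X n ω k)) μ :=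
  M.integrable_X_mul n k ((integrable_const 1).sub (M.integrable_X n k))

lemma tendsto_integral_X_mul_one_sub (M : RAModel K Ω μ) {π : Fin K → ℝ}
    (hπ_pos : ∀ k, 0 < π k) (hπ_sum : ∑ k, π k = 1)
    (hπ_eig : ∀ j, ∑ i, π i * M.T i j = π j) (k : Fin K) :
    Tendsto (fun n => ∫ ω, M.X n ω k * (1 - M.X n ω k) ∂μ) atTop (nhds 0) := by
  set V : ℕ → ℝ := fun n => ∫ ω, M.average π n ω ^ 2 ∂μ
  have hpos (n : ℕ) (i : Fin K) : 0 ≤ ∫ ω, M.X n ω i * (1 - M.X n ω i) ∂μ :=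
    integral_nonneg fun ω => (M.X_mul_one_sub_mem_Icc n ω i).1
  have hterm (n : ℕ) (i : Fin K) : 0 ≤ π i ^ 2 * ∫ ω, M.X n ω i * (1 - M.X n ω i) ∂μ :=
    mul_nonneg (sq_nonneg _) (hpos n i)
  have hV (n : ℕ) : V (n + 1) = V n
      + M.α ^ 2 * ∑ k, π k ^ 2 * ∫ ω, M.X n ω k * (1 - M.X n ω k) ∂μ :=
    M.integral_average_sq_succ hπ_eig n
  have hmono : Monotone V := monotone_nat_of_le_succ fun n => by
    rw [hV]
    exact le_add_of_nonneg_right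
      (mul_nonneg (sq_nonneg _) (Finset.sum_nonneg fun i _ => hterm n i))
  have hbdd : BddAbove (Set.range V) := by
    refine ⟨1, ?_⟩
    rintro _ ⟨n, rfl⟩
    have h := norm_integral_le_of_norm_le_const (μ := μ) (f := fun ω => M.average π n ω ^ 2)
      (C := 1) (.of_forall fun ω => by
        obtain ⟨h₀, h₁⟩ := M.average_mem_Icc (fun i => (hπ_pos i).le) hπ_sum n ω
        rw [Real.norm_of_nonneg (sq_nonneg _)]
        exact pow_le_one₀ h₀ h₁)
    exact (Real.le_norm_self _).trans (by simpa using h)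
  have hlim := tendsto_atTop_ciSup hmono hbdd
  have hdiff : Tendsto (fun n => (V (n + 1) - V n) / (M.α ^ 2 * π k ^ 2)) atTop (nhds 0) := by
    simpa using (((tendsto_add_atTop_iff_nat 1).2 hlim).sub hlim).div_const (M.α ^ 2 * π k ^ 2)
  refine squeeze_zero (fun n => hpos n k) (fun n => ?_) hdiff
  have hα := M.hα.1
  have hπk := hπ_pos k
  rw [le_div_iff₀ (by positivity), hV, add_sub_cancel_left, mul_comm, mul_assoc]
  exact mul_le_mul_of_nonneg_left
    (Finset.single_le_sum (fun i _ => hterm n i) (Finset.mem_univ k)) (sq_nonneg _)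

end Moments

end RAModel

/-- **Mean-square vanishing of `X_k (1 - X_k)` in the RA model.**
In the RA model, with `π` a positive left eigenvector of `T` for eigenvalue `1` normalized to
sum `1`, for every agent `k`, `E[(X_k[n](1 - X_k[n]))²] → 0` as `n → ∞`: the product
`X_k[n](1 - X_k[n])` converges to `0` in the mean square sense. -/
theorem RA_product_ms_convergence {K : ℕ} (hK : 1 ≤ K) {Ω : Type*} [MeasurableSpace Ω]
    {μ : Measure Ω} [IsProbabilityMeasure μ] (M : RAModel K Ω μ)
    (π : Fin K → ℝ) (hπ_pos : ∀ k, 0 < π k) (hπ_sum : ∑ k, π k = 1)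
    (hπ_eig : ∀ j, ∑ i, π i * M.T i j = π j) :
    ∀ k : Fin K,
      Tendsto (fun n => ∫ ω, (M.X n ω k * (1 - M.X n ω k)) ^ 2 ∂μ) atTop (nhds 0) := by
  intro k
  refine squeeze_zero (fun n => integral_nonneg fun ω => sq_nonneg _) (fun n => ?_)
    (M.tendsto_integral_X_mul_one_sub hπ_pos hπ_sum hπ_eig k)
  refine integral_mono_of_nonneg (.of_forall fun ω => sq_nonneg _)
    (M.integrable_X_mul_one_sub n k) (.of_forall fun ω => ?_)
  obtain ⟨h₀, h₁⟩ := M.X_mul_one_sub_mem_Icc n ω k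
  exact pow_le_of_le_one h₀ h₁ two_ne_zero
end
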